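/- arXiv:math/9702214 — 2 statements merged into one kernel-verified Lean document; each statement's English description precedes it below -/
import Mathlib

section
/- Let ℓ_{w,p} be a Lorentz sequence space with 1 < p < ∞ and w₂ > 0. Suppose Y = ker f is the range of a norm-one projection on ℓ_{w,p} and card(supp f) ≥ n > 2. Then p = 2 and w₁ = w₂ = … = wₙ = 1. -/
open ENNReal

/-- `Σₙ wₙ (xₙ*)ᵖ` for the Lorentz space `ℓ_{w,p}`, expressed as the supremum
over injections (valid for nonincreasing nonnegative weights). -/
noncomputable def lorentzSum (w : ℕ → ℝ) (p : ℝ) (x : ℕ → ℝ) : ℝ≥0∞ :=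
  ⨆ π : {g : ℕ → ℕ // Function.Injective g},
    ∑' n, ENNReal.ofReal (w n * |x (π.1 n)| ^ p)

open Filter Topology

theorem lorentzSum_le_add {w : ℕ → ℝ} (hnn : ∀ n, 0 ≤ w n) {p : ℝ} (hp : 0 ≤ p) {x a b : ℕ → ℝ}
    (h : ∀ i, |x i| ≤ |a i| ∨ |x i| ≤ |b i|) :
    lorentzSum w p x ≤ lorentzSum w p a + lorentzSum w p b := by
  refine iSup_le fun π => ?_
  calc ∑' n, ENNReal.ofReal (w n * |x (π.1 n)| ^ p)
      ≤ ∑' n, (ENNReal.ofReal (w n * |a (π.1 n)| ^ p) +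
          ENNReal.ofReal (w n * |b (π.1 n)| ^ p)) := by
        refine ENNReal.tsum_le_tsum fun n => ?_
        rcases h (π.1 n) with h | h
        · refine le_trans (ENNReal.ofReal_le_ofReal ?_) le_self_add
          exact mul_le_mul_of_nonneg_left (Real.rpow_le_rpow (abs_nonneg _) h hp) (hnn n)
        · refine le_trans (ENNReal.ofReal_le_ofReal ?_) le_add_self
          exact mul_le_mul_of_nonneg_left (Real.rpow_le_rpow (abs_nonneg _) h hp) (hnn n)
    _ = _ := ENNReal.tsum_add
    _ ≤ _ := add_le_add
        (le_iSup (fun π : {g : ℕ → ℕ // Function.Injective g} =>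
          ∑' n, ENNReal.ofReal (w n * |a (π.1 n)| ^ p)) π)
        (le_iSup (fun π : {g : ℕ → ℕ // Function.Injective g} =>
          ∑' n, ENNReal.ofReal (w n * |b (π.1 n)| ^ p)) π)

theorem lorentzSum_smul_le (w : ℕ → ℝ) (p t : ℝ) (x : ℕ → ℝ) :
    lorentzSum w p (t • x) ≤ ENNReal.ofReal (|t| ^ p) * lorentzSum w p x := by
  refine iSup_le fun π => ?_
  calc ∑' n, ENNReal.ofReal (w n * |(t • x) (π.1 n)| ^ p)
      = ∑' n, ENNReal.ofReal (|t| ^ p) * ENNReal.ofReal (w n * |x (π.1 n)| ^ p) := by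
        refine tsum_congr fun n => ?_
        rw [← ENNReal.ofReal_mul (by positivity), Pi.smul_apply, smul_eq_mul, abs_mul,
          Real.mul_rpow (abs_nonneg _) (abs_nonneg _)]
        congr 1
        ring
    _ = _ := ENNReal.tsum_mul_left
    _ ≤ _ := by
        gcongr
        exact le_iSup (fun π : {g : ℕ → ℕ // Function.Injective g} =>
          ∑' n, ENNReal.ofReal (w n * |x (π.1 n)| ^ p)) π

theorem sum_le_sum_range_of_antitone {w : ℕ → ℝ} (hmono : Antitone w) (hnn : ∀ n, 0 ≤ w n)
    (T : Finset ℕ) {m : ℕ} (hT : T.card ≤ m) : ∑ n ∈ T, w n ≤ ∑ n ∈ Finset.range m, w n := by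
  calc ∑ n ∈ T, w n ≤ ∑ n ∈ Finset.range T.card, w n := by
        clear hT
        induction T using Finset.induction_on_max with
        | empty => simp
        | insert a s hs ih =>
          have ha : a ∉ s := fun h => lt_irrefl a (hs a h)
          rw [Finset.sum_insert ha, Finset.card_insert_of_notMem ha, Finset.sum_range_succ,
            add_comm]
          have hcard : s.card ≤ a := by
            simpa using Finset.card_le_card
              (show s ⊆ Finset.range a from fun x hx => Finset.mem_range.2 (hs x hx))
          exact add_le_add ih (hmono hcard)
    _ ≤ _ := Finset.sum_le_sum_of_subset_of_nonneg (Finset.range_mono hT) fun i _ _ => hnn i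

/-- A rearrangement inequality for partial injections. -/
theorem sum_mul_comp_le_sum_range {w : ℕ → ℝ} (hmono : Antitone w) (hnn : ∀ n, 0 ≤ w n)
    (m : ℕ) (b : ℕ → ℝ) (hb0 : ∀ k < m, 0 ≤ b k) (hb : ∀ k l, k < l → l < m → b l ≤ b k)
    (T : Finset ℕ) (σ : ℕ → ℕ) (hσ : Set.InjOn σ T) (hm : ∀ n ∈ T, σ n < m) :
    ∑ n ∈ T, w n * b (σ n) ≤ ∑ k ∈ Finset.range m, w k * b k := by
  induction m generalizing b T with
  | zero =>
    have : T = ∅ := Finset.eq_empty_of_forall_notMem fun n hn => by simpa using hm n hn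
    simp [this]
  | succ m ih =>
    have hcard : T.card ≤ m + 1 := by
      rw [← Finset.card_range (m + 1)]
      exact Finset.card_le_card_of_injOn σ (fun n hn => by simpa using hm n hn) hσ
    have h1 := ih (fun k => b k - b m) (fun k hk => sub_nonneg.2 (hb k m hk (by omega)))
      (fun k l hkl hl => sub_le_sub_right (hb k l hkl (by omega)) _)
      (T.filter fun n => σ n < m)
      (hσ.mono (Finset.coe_subset.2 (Finset.filter_subset _ _))) (fun n hn => (Finset.mem_filter.1 hn).2)
    have h2 : ∑ n ∈ T with σ n < m, w n * (b (σ n) - b m) = ∑ n ∈ T, w n * (b (σ n) - b m) := by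
      refine Finset.sum_filter_of_ne fun n hn hne => ?_
      refine lt_of_le_of_ne (Nat.lt_succ_iff.1 (hm n hn)) fun h => hne ?_
      rw [h, sub_self, mul_zero]
    have h3 := mul_le_mul_of_nonneg_right (sum_le_sum_range_of_antitone hmono hnn T hcard)
      (hb0 m (by omega))
    rw [h2] at h1
    simp only [mul_sub, Finset.sum_sub_distrib, ← Finset.sum_mul] at h1
    rw [Finset.sum_range_succ, add_mul] at h3
    rw [Finset.sum_range_succ]
    linarith

theorem lorentzSum_le_of_ordered {w : ℕ → ℝ} (hmono : Antitone w) (hnn : ∀ n, 0 ≤ w n)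
    {p : ℝ} (hp : 0 < p) {e : ℕ → ℕ} (he : Function.Injective e) (m : ℕ) {u : ℕ → ℝ}
    (hu : ∀ k l, k < l → l < m → |u (e l)| ≤ |u (e k)|)
    (hsupp : ∀ i ∉ (Finset.range m).image e, u i = 0) :
    lorentzSum w p u ≤ ENNReal.ofReal (∑ k ∈ Finset.range m, w k * |u (e k)| ^ p) := by
  refine iSup_le fun π => ?_
  set S := (Finset.range m).image e
  set T := S.preimage π.1 π.2.injOn
  have hT : ∀ n ∈ T, ∃ k < m, e k = π.1 n := fun n hn => by simpa [T, S] using hn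
  rw [tsum_eq_sum (s := T), ← ENNReal.ofReal_sum_of_nonneg
    fun n _ => mul_nonneg (hnn n) (by positivity)]
  · refine ENNReal.ofReal_le_ofReal ?_
    have hinv : ∀ n ∈ T, Function.invFun e (π.1 n) < m ∧ e (Function.invFun e (π.1 n)) = π.1 n := by
      intro n hn
      obtain ⟨k, hk, hkn⟩ := hT n hn
      rw [← hkn, Function.leftInverse_invFun he k]
      exact ⟨hk, rfl⟩
    have := sum_mul_comp_le_sum_range hmono hnn m (fun k => |u (e k)| ^ p)
      (fun k _ => by positivity)
      (fun k l hkl hl => Real.rpow_le_rpow (abs_nonneg _) (hu k l hkl hl) hp.le)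
      T (fun n => Function.invFun e (π.1 n))
      (fun n hn n' hn' h => π.2 (by
        rw [← (hinv n hn).2, ← (hinv n' hn').2]; exact congrArg e h))
      (fun n hn => (hinv n hn).1)
    refine le_trans (le_of_eq (Finset.sum_congr rfl fun n hn => ?_)) this
    simp only [(hinv n hn).2]
  · intro n hn
    have : π.1 n ∉ S := fun h => hn (by simpa [T] using h)
    simp [hsupp _ this, Real.zero_rpow hp.ne']

theorem le_lorentzSum {w : ℕ → ℝ} (hnn : ∀ n, 0 ≤ w n) (p : ℝ) {e : ℕ → ℕ}
    (he : Function.Injective e) (m : ℕ) (u : ℕ → ℝ) :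
    ENNReal.ofReal (∑ k ∈ Finset.range m, w k * |u (e k)| ^ p) ≤ lorentzSum w p u := by
  rw [ENNReal.ofReal_sum_of_nonneg fun n _ => mul_nonneg (hnn n) (by positivity)]
  exact (ENNReal.sum_le_tsum _).trans
    (le_iSup (fun π : {g : ℕ → ℕ // Function.Injective g} =>
      ∑' n, ENNReal.ofReal (w n * |u (π.1 n)| ^ p)) ⟨e, he⟩)

/-- The first `m` entries of `y ∘ e` are nonzero and strictly decreasing in absolute value. -/
def IsOrderedOn (e : ℕ → ℕ) (m : ℕ) (y : ℕ → ℝ) : Prop :=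
  (∀ k < m, y (e k) ≠ 0) ∧ ∀ k l, k < l → l < m → |y (e l)| < |y (e k)|

theorem tendsto_add_smul_apply (y d : ℕ → ℝ) (i : ℕ) :
    Tendsto (fun t : ℝ => (y + t • d) i) (𝓝 0) (𝓝 (y i)) := by
  have : Continuous fun t : ℝ => (y + t • d) i := by
    simp only [Pi.add_apply, Pi.smul_apply, smul_eq_mul]
    fun_prop
  simpa using this.tendsto 0

theorem IsOrderedOn.eventually {e : ℕ → ℕ} {m : ℕ} {y : ℕ → ℝ} (h : IsOrderedOn e m y)
    (d : ℕ → ℝ) : ∀ᶠ t : ℝ in 𝓝 0, IsOrderedOn e m (y + t • d) := by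
  have h1 : ∀ᶠ t : ℝ in 𝓝 0, ∀ k ∈ Finset.range m, (y + t • d) (e k) ≠ 0 := by
    rw [Filter.eventually_all_finset]
    exact fun k hk => (tendsto_add_smul_apply y d (e k)).eventually_ne (h.1 k (by simpa using hk))
  have h2 : ∀ᶠ t : ℝ in 𝓝 0, ∀ l ∈ Finset.range m, ∀ k ∈ Finset.range l,
      |(y + t • d) (e l)| < |(y + t • d) (e k)| := by
    rw [Filter.eventually_all_finset]
    intro l hl
    rw [Filter.eventually_all_finset]
    intro k hk
    exact (tendsto_add_smul_apply y d (e l)).abs.eventually_lt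
      (tendsto_add_smul_apply y d (e k)).abs
      (h.2 k l (by simpa using hk) (by simpa using hl))
  filter_upwards [h1, h2] with t h1 h2
  exact ⟨fun k hk => h1 k (by simpa using hk),
    fun k l hkl hl => h2 l (by simpa using hl) k (by simpa using hkl)⟩

/-- First-order condition for minimality of the Lorentz functional along a line. -/
theorem sum_mul_eq_zero_of_isOrderedOn {w : ℕ → ℝ} (hmono : Antitone w) (hnn : ∀ n, 0 ≤ w n)
    {p : ℝ} (hp : 1 < p) {e : ℕ → ℕ} (he : Function.Injective e) {m : ℕ} {y z : ℕ → ℝ}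
    (hy : IsOrderedOn e m y) (hsupp : ∀ i ∉ (Finset.range m).image e, y i = 0)
    (hz : lorentzSum w p z ≠ ⊤) (hmin : ∀ t : ℝ, lorentzSum w p y ≤ lorentzSum w p (y + t • z)) :
    ∑ k ∈ Finset.range m, w k * (|y (e k)| ^ (p - 2) * y (e k)) * z (e k) = 0 := by
  set C := (lorentzSum w p z).toReal
  set h : ℝ → ℝ := fun t =>
    ∑ k ∈ Finset.range m, w k * |y (e k) + t * z (e k)| ^ p + |t| ^ p * C with hh
  have hloc : IsLocalMin h 0 := by
    filter_upwards [hy.eventually z] with t ht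
    have hu := lorentzSum_le_of_ordered hmono hnn (by linarith : 0 < p) he m
      (u := fun i => if i ∈ (Finset.range m).image e then (y + t • z) i else 0)
      (fun k l hkl hl => by
        have hk : k < m := hkl.trans hl
        have h1 : e k ∈ (Finset.range m).image e :=
          Finset.mem_image_of_mem _ (Finset.mem_range.2 hk)
        have h2 : e l ∈ (Finset.range m).image e :=
          Finset.mem_image_of_mem _ (Finset.mem_range.2 hl)
        simpa only [if_pos h1, if_pos h2] using (ht.2 k l hkl hl).le)
      (fun i hi => if_neg hi)
    have hsum : ∑ k ∈ Finset.range m, w k *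
        |if e k ∈ (Finset.range m).image e then (y + t • z) (e k) else 0| ^ p =
        ∑ k ∈ Finset.range m, w k * |y (e k) + t * z (e k)| ^ p := by
      refine Finset.sum_congr rfl fun k hk => ?_
      rw [if_pos (Finset.mem_image_of_mem _ hk)]
      rfl
    rw [hsum] at hu
    have key : ENNReal.ofReal (∑ k ∈ Finset.range m, w k * |y (e k)| ^ p) ≤
        ENNReal.ofReal (h t) := by
      calc _ ≤ lorentzSum w p y := le_lorentzSum hnn p he m y
        _ ≤ lorentzSum w p (y + t • z) := hmin t
        _ ≤ _ + lorentzSum w p (t • z) := by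
            refine lorentzSum_le_add hnn (by linarith)
              (a := fun i => if i ∈ (Finset.range m).image e then (y + t • z) i else 0)
              fun i => ?_
            by_cases hi : i ∈ (Finset.range m).image e
            · left
              rw [if_pos hi]
            · right
              rw [Pi.add_apply, hsupp i hi, zero_add]
        _ ≤ ENNReal.ofReal (∑ k ∈ Finset.range m, w k * |y (e k) + t * z (e k)| ^ p) +
            ENNReal.ofReal (|t| ^ p) * lorentzSum w p z :=
            add_le_add hu (lorentzSum_smul_le w p t z)
        _ = ENNReal.ofReal (h t) := by
            rw [hh, ENNReal.ofReal_add
              (Finset.sum_nonneg fun k _ => mul_nonneg (hnn k) (by positivity))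
              (by positivity), ENNReal.ofReal_mul (by positivity), ENNReal.ofReal_toReal hz]
    rw [ENNReal.ofReal_le_ofReal_iff (add_nonneg
      (Finset.sum_nonneg fun k _ => mul_nonneg (hnn k) (by positivity)) (by positivity))] at key
    simpa [hh, Real.zero_rpow (by linarith : p ≠ 0)] using key
  have hder : HasDerivAt h (∑ k ∈ Finset.range m,
      w k * (p * |y (e k)| ^ (p - 2) * y (e k) * z (e k)) + 0 * C) 0 := by
    refine HasDerivAt.add (HasDerivAt.fun_sum fun k _ => ?_) (HasDerivAt.mul_const ?_ C)
    · refine HasDerivAt.const_mul _ ?_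
      have h1 : HasDerivAt (fun t : ℝ => y (e k) + t * z (e k)) (z (e k)) 0 := by
        simpa using ((hasDerivAt_id (0 : ℝ)).mul_const (z (e k))).const_add (y (e k))
      have h2 : HasDerivAt (fun x : ℝ => |x| ^ p) (p * |y (e k)| ^ (p - 2) * y (e k))
          (y (e k) + 0 * z (e k)) := by
        simpa using hasDerivAt_abs_rpow (y (e k)) hp
      exact h2.comp (0 : ℝ) h1
    · simpa using hasDerivAt_abs_rpow 0 hp
  have h0 := hloc.hasDerivAt_eq_zero hder
  have h1 : p * ∑ k ∈ Finset.range m, w k * (|y (e k)| ^ (p - 2) * y (e k)) * z (e k) = 0 := by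
    rw [← h0, zero_mul, add_zero, Finset.mul_sum]
    exact Finset.sum_congr rfl fun k _ => by ring
  exact (mul_eq_zero.1 h1).resolve_left (by linarith)

theorem hasDerivAt_abs_rpow_mul_self (q : ℝ) {x : ℝ} (hx : x ≠ 0) :
    HasDerivAt (fun x : ℝ => |x| ^ q * x) ((q + 1) * |x| ^ q) x := by
  have hpos : 0 < |x| := abs_pos.2 hx
  have h1 : HasDerivAt (fun x : ℝ => |x| ^ q) (SignType.sign x * q * |x| ^ (q - 1)) x :=
    (hasDerivAt_abs hx).rpow_const (Or.inl hpos.ne')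
  refine (h1.mul (hasDerivAt_id x)).congr_deriv ?_
  have h2 : |x| ^ (q - 1) * |x| = |x| ^ q := by
    rw [Real.rpow_sub_one hpos.ne', div_mul_cancel₀ _ hpos.ne']
  calc (SignType.sign x : ℝ) * q * |x| ^ (q - 1) * id x + |x| ^ q * 1
      = q * (|x| ^ (q - 1) * (SignType.sign x * x)) + |x| ^ q := by simp only [id]; ring
    _ = (q + 1) * |x| ^ q := by rw [sign_mul_self, h2]; ring

/-- Second-order consequence: if every vector supported on `S` in the kernel of `g` is
Birkhoff orthogonal to `z`, then the coordinates of `z` and `g` are proportional up to the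
weights. -/
theorem weight_mul_ratio_eq {w : ℕ → ℝ} (hmono : Antitone w) (hnn : ∀ n, 0 ≤ w n)
    {p : ℝ} (hp : 1 < p) {e : ℕ → ℕ} (he : Function.Injective e) {m : ℕ} {g y z : ℕ → ℝ}
    {S : Finset ℕ} (hS : (Finset.range m).image e = S) (hg : ∀ i ∈ S, g i ≠ 0)
    (hz : lorentzSum w p z ≠ ⊤)
    (hmin : ∀ y : ℕ → ℝ, (∀ i ∉ S, y i = 0) →
      ∑ i ∈ S, g i * y i = 0 →
      ∀ t : ℝ, lorentzSum w p y ≤ lorentzSum w p (y + t • z))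
    (hy : IsOrderedOn e m y) (hsupp : ∀ i ∉ S, y i = 0)
    (hker : ∑ i ∈ S, g i * y i = 0) {k l : ℕ} (hk : k < m) (hl : l < m) :
    w k * |y (e k)| ^ (p - 2) * (z (e k) / g (e k)) =
      w l * |y (e l)| ^ (p - 2) * (z (e l) / g (e l)) := by
  have hkS : e k ∈ S := hS ▸ Finset.mem_image_of_mem _ (Finset.mem_range.2 hk)
  have hlS : e l ∈ S := hS ▸ Finset.mem_image_of_mem _ (Finset.mem_range.2 hl)
  set d : ℕ → ℝ := Pi.single (e k) (g (e l)) - Pi.single (e l) (g (e k)) with hd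
  have hd0 : ∀ i ∉ S, d i = 0 := by
    intro i hi
    have h1 : i ≠ e k := fun h => hi (h ▸ hkS)
    have h2 : i ≠ e l := fun h => hi (h ▸ hlS)
    simp [hd, h1, h2]
  have hdker : ∑ i ∈ S, g i * d i = 0 := by
    simp [hd, mul_sub, Finset.sum_sub_distrib, Pi.single_apply, hkS, hlS, mul_comm]
  have hev : (fun t : ℝ => ∑ j ∈ Finset.range m,
      w j * (|y (e j) + t * d (e j)| ^ (p - 2) * (y (e j) + t * d (e j))) * z (e j))
      =ᶠ[𝓝 0] fun _ => (0 : ℝ) := by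
    filter_upwards [hy.eventually d] with t ht
    have hs : ∀ i ∉ S, (y + t • d) i = 0 := fun i hi => by simp [hsupp i hi, hd0 i hi]
    refine sum_mul_eq_zero_of_isOrderedOn hmono hnn hp he ht (hS ▸ hs) hz (hmin _ hs ?_)
    calc ∑ i ∈ S, g i * (y + t • d) i = ∑ i ∈ S, g i * y i + t * ∑ i ∈ S, g i * d i := by
          rw [Finset.mul_sum, ← Finset.sum_add_distrib]
          refine Finset.sum_congr rfl fun i _ => ?_
          simp only [Pi.add_apply, Pi.smul_apply, smul_eq_mul]
          ring
      _ = 0 := by rw [hker, hdker]; ring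
  have hder : HasDerivAt (fun t : ℝ => ∑ j ∈ Finset.range m,
      w j * (|y (e j) + t * d (e j)| ^ (p - 2) * (y (e j) + t * d (e j))) * z (e j))
      (∑ j ∈ Finset.range m, w j * ((p - 2 + 1) * |y (e j)| ^ (p - 2) * d (e j)) * z (e j)) 0 := by
    refine HasDerivAt.fun_sum fun j hj => HasDerivAt.mul_const (HasDerivAt.const_mul _ ?_) _
    have h1 : HasDerivAt (fun t : ℝ => y (e j) + t * d (e j)) (d (e j)) 0 := by
      simpa using ((hasDerivAt_id (0 : ℝ)).mul_const (d (e j))).const_add (y (e j))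
    have h2 : HasDerivAt (fun x : ℝ => |x| ^ (p - 2) * x) ((p - 2 + 1) * |y (e j)| ^ (p - 2))
        (y (e j) + 0 * d (e j)) := by
      simpa using hasDerivAt_abs_rpow_mul_self (p - 2) (hy.1 j (Finset.mem_range.1 hj))
    exact h2.comp (0 : ℝ) h1
  have h0 := (hder.congr_of_eventuallyEq hev.symm).unique (hasDerivAt_const (0 : ℝ) (0 : ℝ))
  have h1 : ∑ j ∈ Finset.range m,
      w j * ((p - 2 + 1) * |y (e j)| ^ (p - 2) * d (e j)) * z (e j) =
      (p - 1) * (w k * |y (e k)| ^ (p - 2) * z (e k) * g (e l) -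
        w l * |y (e l)| ^ (p - 2) * z (e l) * g (e k)) := by
    simp only [hd, Pi.sub_apply, Pi.single_apply, he.eq_iff, mul_sub, sub_mul,
      Finset.sum_sub_distrib, mul_ite, ite_mul, mul_zero, zero_mul, Finset.sum_ite_eq',
      Finset.mem_range, hk, hl, if_true]
    ring
  rw [h1] at h0
  have h2 := (mul_eq_zero.1 h0).resolve_left (by linarith)
  have hgk := hg _ hkS
  have hgl := hg _ hlS
  field_simp
  linarith

theorem exists_generic_mem_ker {S : Finset ℕ} (hS : 3 ≤ S.card) {g : ℕ → ℝ}
    (hg : ∀ i ∈ S, g i ≠ 0) :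
    ∃ d : ℕ → ℝ, (∀ i ∉ S, d i = 0) ∧ ∑ i ∈ S, g i * d i = 0 ∧
      (∀ i ∈ S, ∀ j ∈ S, d i + d j ≠ 0) ∧ ∀ i ∈ S, ∀ j ∈ S, i ≠ j → d i - d j ≠ 0 := by
  let V : Submodule ℝ (ℕ → ℝ) :=
    { carrier := {d | (∀ i ∉ S, d i = 0) ∧ ∑ i ∈ S, g i * d i = 0}
      add_mem' := fun {a b} ha hb => by
        refine ⟨fun i hi => by simp [ha.1 i hi, hb.1 i hi], ?_⟩
        simp only [Pi.add_apply, mul_add, Finset.sum_add_distrib, ha.2, hb.2, add_zero]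
      zero_mem' := by simp
      smul_mem' := fun c a ha => by
        refine ⟨fun i hi => by simp [ha.1 i hi], ?_⟩
        simp only [Pi.smul_apply, smul_eq_mul, mul_left_comm _ c, ← Finset.mul_sum, ha.2,
          mul_zero] }
  have hV : ∀ i ∈ S, ∀ j, ∃ d ∈ V, d i ≠ 0 ∧ (j ≠ i → d j = 0) := by
    intro i hi j
    obtain ⟨k, hk, hki⟩ : ∃ k ∈ S, k ∉ ({i, j} : Finset ℕ) :=
      Finset.exists_mem_notMem_of_card_lt_card (lt_of_le_of_lt Finset.card_le_two (by omega))
    simp only [Finset.mem_insert, Finset.mem_singleton, not_or] at hki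
    refine ⟨Pi.single i (g k) - Pi.single k (g i), ⟨fun l hl => ?_, ?_⟩, ?_, fun hji => ?_⟩
    · have h1 : l ≠ i := fun h => hl (h ▸ hi)
      have h2 : l ≠ k := fun h => hl (h ▸ hk)
      simp [h1, h2]
    · simp [mul_sub, Finset.sum_sub_distrib, Pi.single_apply, hi, hk, mul_comm]
    · simpa [Ne.symm hki.1] using hg k hk
    · simp [hji, Ne.symm hki.2]
  let c : ℕ → Module.Dual ℝ (ℕ → ℝ) := fun i => LinearMap.proj i
  let f : (S × S) ⊕ (S × S) → Module.Dual ℝ (ℕ → ℝ) := fun q =>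
    match q with
    | .inl (i, j) => c i + c j
    | .inr (i, j) => if i = j then c i
        else c i - c j
  obtain ⟨d, hd, hf⟩ := Module.Dual.exists_forall_mem_ne_zero_of_forall_exists V f (by
    rintro (⟨i, j⟩ | ⟨i, j⟩)
    · obtain ⟨d, hd, h1, h2⟩ := hV i i.2 j
      refine ⟨d, hd, ?_⟩
      by_cases hij : (j : ℕ) = i
      · simpa [f, c, hij] using h1
      · simpa [f, c, h2 hij] using h1
    · obtain ⟨d, hd, h1, h2⟩ := hV i i.2 j
      refine ⟨d, hd, ?_⟩
      by_cases hij : i = j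
      · simpa [f, c, hij] using hij ▸ h1
      · have : (j : ℕ) ≠ i := fun h => hij (Subtype.ext h.symm)
        simpa [f, c, hij, h2 this] using h1)
  refine ⟨d, hd.1, hd.2, fun i hi j hj => ?_, fun i hi j hj hij => ?_⟩
  · simpa [f, c] using hf (.inl (⟨i, hi⟩, ⟨j, hj⟩))
  · simpa [f, c, hij] using hf (.inr (⟨i, hi⟩, ⟨j, hj⟩))

theorem eventually_add_mul_ne_zero (a : ℝ) {b : ℝ} (hb : b ≠ 0) :
    ∀ᶠ t : ℝ in 𝓝[≠] 0, a + t * b ≠ 0 := by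
  by_cases ha : a = 0
  · filter_upwards [self_mem_nhdsWithin] with t ht
    simpa [ha, hb] using ht
  · have : Tendsto (fun t : ℝ => a + t * b) (𝓝 0) (𝓝 a) := by
      have : Continuous fun t : ℝ => a + t * b := by fun_prop
      simpa using this.tendsto 0
    exact (this.eventually_ne ha).filter_mono nhdsWithin_le_nhds

theorem exists_enum_of_injOn (S : Finset ℕ) {f : ℕ → ℝ} (hf : Set.InjOn f S) :
    ∃ e : ℕ → ℕ, Function.Injective e ∧ (Finset.range S.card).image e = S ∧
      ∀ k l, k < l → l < S.card → f (e l) < f (e k) := by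
  have hcard : (S.image fun i => -f i).card = S.card :=
    Finset.card_image_of_injOn fun i hi j hj h => hf hi hj (neg_injective h)
  let o := (S.image fun i => -f i).orderEmbOfFin hcard
  have ho : ∀ k, ∃ i ∈ S, -f i = o k := fun k =>
    Finset.mem_image.1 ((S.image fun i => -f i).orderEmbOfFin_mem hcard k)
  choose s hsS hs using ho
  have hinj : Function.Injective s := fun k l h => o.injective (by rw [← hs, ← hs, h])
  let c := (S.finite_toSet.infinite_compl).natEmbedding
  have hc : ∀ n, (c n : ℕ) ∉ S := fun n => (c n).2
  let e : ℕ → ℕ := fun k => if h : k < S.card then s ⟨k, h⟩ else c k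
  have he : ∀ k (h : k < S.card), e k = s ⟨k, h⟩ := fun k h => dif_pos h
  have he' : ∀ k, ¬ k < S.card → e k = c k := fun k h => dif_neg h
  have heinj : Function.Injective e := by
    intro k l h
    by_cases hk : k < S.card <;> by_cases hl : l < S.card
    · rw [he k hk, he l hl] at h
      simpa using hinj h
    · rw [he k hk, he' l hl] at h
      exact absurd (h ▸ hsS _) (hc l)
    · rw [he' k hk, he l hl] at h
      exact absurd (h ▸ hsS _) (hc k)
    · rw [he' k hk, he' l hl] at h
      exact c.injective (Subtype.ext h)
  refine ⟨e, heinj, ?_, fun k l hkl hl => ?_⟩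
  · refine Finset.eq_of_subset_of_card_le (fun i hi => ?_) ?_
    · obtain ⟨k, hk, rfl⟩ := Finset.mem_image.1 hi
      rw [he k (Finset.mem_range.1 hk)]
      exact hsS _
    · rw [Finset.card_image_of_injective _ heinj, Finset.card_range]
  · have h : o ⟨k, hkl.trans hl⟩ < o ⟨l, hl⟩ := o.strictMono hkl
    rw [← hs, ← hs] at h
    rw [he l hl, he k (hkl.trans hl)]
    exact neg_lt_neg_iff.1 h

/-- Every vector of the kernel of `g` supported on `S` is a limit of vectors of that kernel
whose entries on `S` are nonzero with distinct absolute values. -/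
theorem exists_isOrderedOn_of_eventually {S : Finset ℕ} (hS : 3 ≤ S.card) {g : ℕ → ℝ}
    (hg : ∀ i ∈ S, g i ≠ 0) {y₀ : ℕ → ℝ} (hsupp : ∀ i ∉ S, y₀ i = 0)
    (hker : ∑ i ∈ S, g i * y₀ i = 0) {Q : (ℕ → ℝ) → Prop} (hQ : ∀ᶠ y in 𝓝 y₀, Q y) :
    ∃ y : ℕ → ℝ, ∃ e : ℕ → ℕ, Q y ∧ (∀ i ∉ S, y i = 0) ∧ ∑ i ∈ S, g i * y i = 0 ∧
      Function.Injective e ∧ (Finset.range S.card).image e = S ∧ IsOrderedOn e S.card y := by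
  obtain ⟨d, hd0, hdker, hadd, hsub⟩ := exists_generic_mem_ker hS hg
  have hcont : Continuous fun t : ℝ => y₀ + t • d := by fun_prop
  have hQ' : ∀ᶠ t : ℝ in 𝓝[≠] 0, Q (y₀ + t • d) := by
    have : Tendsto (fun t : ℝ => y₀ + t • d) (𝓝 0) (𝓝 y₀) := by simpa using hcont.tendsto 0
    exact (this.eventually hQ).filter_mono nhdsWithin_le_nhds
  have h1 : ∀ᶠ t : ℝ in 𝓝[≠] 0, ∀ i ∈ S, ∀ j ∈ S, (y₀ i + y₀ j) + t * (d i + d j) ≠ 0 := by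
    simp only [Filter.eventually_all_finset]
    exact fun i hi j hj => eventually_add_mul_ne_zero _ (hadd i hi j hj)
  have h2 : ∀ᶠ t : ℝ in 𝓝[≠] 0, ∀ i ∈ S, ∀ j ∈ S, i ≠ j →
      (y₀ i - y₀ j) + t * (d i - d j) ≠ 0 := by
    simp only [Filter.eventually_all_finset]
    intro i hi j hj
    by_cases hij : i = j
    · simp [hij]
    · filter_upwards [eventually_add_mul_ne_zero (y₀ i - y₀ j) (hsub i hi j hj hij)] with t ht _
      exact ht
  obtain ⟨t, hQt, ht1, ht2⟩ := (hQ'.and (h1.and h2)).exists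
  have hinj : Set.InjOn (fun i => |(y₀ + t • d) i|) S := by
    intro i hi j hj h
    by_contra hij
    rcases abs_eq_abs.1 h with h | h
    · refine ht2 i hi j hj hij ?_
      simp only [Pi.add_apply, Pi.smul_apply, smul_eq_mul] at h
      linarith
    · refine ht1 i hi j hj ?_
      simp only [Pi.add_apply, Pi.smul_apply, smul_eq_mul] at h
      linarith
  obtain ⟨e, he, heS, hord⟩ := exists_enum_of_injOn S hinj
  refine ⟨y₀ + t • d, e, hQt, fun i hi => by simp [hsupp i hi, hd0 i hi], ?_, he, heS,
    fun k hk h => ?_, hord⟩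
  · simp only [Pi.add_apply, Pi.smul_apply, smul_eq_mul, mul_add, Finset.sum_add_distrib, hker,
      mul_left_comm _ t, ← Finset.mul_sum, hdker, mul_zero, add_zero]
  · have hkS : e k ∈ S := heS ▸ Finset.mem_image_of_mem _ (Finset.mem_range.2 hk)
    refine ht1 _ hkS _ hkS ?_
    simp only [Pi.add_apply, Pi.smul_apply, smul_eq_mul] at h
    linarith

/-- The rigidity statement for a finite set `S` on which `g` does not vanish and a vector `z` to
which the kernel of `g` is Birkhoff orthogonal. -/
theorem eq_two_and_weight_eq_one {w : ℕ → ℝ} (hmono : Antitone w) (hnn : ∀ n, 0 ≤ w n)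
    (hw0 : w 0 = 1) (hw1 : 0 < w 1) {p : ℝ} (hp : 1 < p) {g z : ℕ → ℝ} {S : Finset ℕ}
    (hS : 3 ≤ S.card) (hg : ∀ i ∈ S, g i ≠ 0) (hz : lorentzSum w p z ≠ ⊤)
    (hmin : ∀ y : ℕ → ℝ, (∀ i ∉ S, y i = 0) → ∑ i ∈ S, g i * y i = 0 →
      ∀ t : ℝ, lorentzSum w p y ≤ lorentzSum w p (y + t • z))
    {i₁ : ℕ} (hi₁ : i₁ ∈ S) (hzi : z i₁ ≠ 0) : p = 2 ∧ w (S.card - 1) = 1 := by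
  have habs : ∀ {y₀ : ℕ → ℝ} {i j : ℕ}, |y₀ i| < |y₀ j| → ∀ᶠ y : ℕ → ℝ in 𝓝 y₀, |y i| < |y j| :=
    fun {y₀ i j} h => (continuous_apply i).abs.continuousAt.eventually_lt
      (continuous_apply j).abs.continuousAt h
  have hidx : ∀ {e : ℕ → ℕ}, (Finset.range S.card).image e = S → ∀ i ∈ S, ∃ k < S.card, e k = i :=
    fun {e} he i hi => by
      rw [← he] at hi
      simpa using hi
  have hmem : ∀ {e : ℕ → ℕ}, (Finset.range S.card).image e = S → ∀ k < S.card, e k ∈ S :=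
    fun {e} he k hk => he ▸ Finset.mem_image_of_mem _ (Finset.mem_range.2 hk)
  -- A vector for which `i₁` has one of the two largest entries.
  obtain ⟨hρ, hp2⟩ : (∀ i ∈ S, z i / g i ≠ 0) ∧ p = 2 := by
    obtain ⟨j, hj, hji⟩ : ∃ j ∈ S, j ≠ i₁ := by
      obtain ⟨j, hj, hji⟩ := Finset.exists_mem_notMem_of_card_lt_card
        (s := {i₁}) (t := S) (by simp; omega)
      exact ⟨j, hj, by simpa using hji⟩
    obtain ⟨y, e, hQ, hsupp, hker, he, heS, hy⟩ := exists_isOrderedOn_of_eventually hS hg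
      (y₀ := Pi.single i₁ (g j) - Pi.single j (g i₁))
      (fun i hi => by
        have h1 : i ≠ i₁ := fun h => hi (h ▸ hi₁)
        have h2 : i ≠ j := fun h => hi (h ▸ hj)
        simp [h1, h2])
      (by simp [mul_sub, Finset.sum_sub_distrib, Pi.single_apply, hi₁, hj, mul_comm])
      (Q := fun y => ∀ k ∈ S.filter (fun k => k ≠ i₁ ∧ k ≠ j), |y k| < |y i₁|)
      (by
        rw [Filter.eventually_all_finset]
        intro k hk
        simp only [Finset.mem_filter] at hk
        exact habs (by simpa [hk.2.1, hk.2.2, hji.symm] using hg j hj))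
    obtain ⟨k₁, hk₁, hek₁⟩ := hidx heS i₁ hi₁
    have hk₁' : k₁ ≤ 1 := by
      by_contra! hlt
      have hlarge : ∀ k < k₁, e k = j := by
        intro k hk
        by_contra hne
        have h1 : e k ≠ i₁ := fun h => hk.ne (he (h.trans hek₁.symm))
        have h2 := hQ (e k) (Finset.mem_filter.2 ⟨hmem heS k (hk.trans hk₁), h1, hne⟩)
        have h3 := hy.2 k k₁ hk hk₁
        rw [hek₁] at h3
        exact lt_asymm h2 h3
      exact zero_ne_one (he ((hlarge 0 (by omega)).trans (hlarge 1 hlt).symm))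
    have hwk₁ : w k₁ ≠ 0 := (hw1.trans_le (hmono hk₁')).ne'
    have hpow : ∀ k < S.card, |y (e k)| ^ (p - 2) ≠ 0 := fun k hk =>
      (Real.rpow_pos_of_pos (abs_pos.2 (hy.1 k hk)) _).ne'
    have hne : ∀ k < S.card, w k * |y (e k)| ^ (p - 2) * (z (e k) / g (e k)) ≠ 0 := by
      intro k hk
      rw [weight_mul_ratio_eq hmono hnn hp he heS hg hz hmin hy hsupp hker hk hk₁]
      refine mul_ne_zero (mul_ne_zero hwk₁ (hpow k₁ hk₁)) ?_
      rw [hek₁]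
      exact div_ne_zero hzi (hg _ hi₁)
    have hρ : ∀ k < S.card, z (e k) / g (e k) ≠ 0 := fun k hk => right_ne_zero_of_mul (hne k hk)
    refine ⟨fun i hi => ?_, ?_⟩
    · obtain ⟨k, hk, rfl⟩ := hidx heS i hi
      exact hρ k hk
    -- Varying the largest entry against the third one forces `p = 2`.
    have c0 : 0 < S.card := by omega
    have c1 : 1 < S.card := by omega
    have c2 : 2 < S.card := by omega
    set d : ℕ → ℝ := Pi.single (e 0) (g (e 2)) - Pi.single (e 2) (g (e 0)) with hd
    have hd0 : d (e 0) = g (e 2) := by simp [hd, he.eq_iff]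
    have hd1 : d (e 1) = 0 := by simp [hd, he.eq_iff]
    have hg2 := hg _ (hmem heS 2 c2)
    have hconst : ∀ᶠ t : ℝ in 𝓝 0, p ≠ 2 → |y (e 0) + t * g (e 2)| = |y (e 0)| := by
      filter_upwards [hy.eventually d] with t ht hp2
      have hs : ∀ i ∉ S, (y + t • d) i = 0 := by
        intro i hi
        have h1 : i ≠ e 0 := fun h => hi (h ▸ hmem heS 0 c0)
        have h2 : i ≠ e 2 := fun h => hi (h ▸ hmem heS 2 c2)
        simp [hd, hsupp i hi, h1, h2]
      have hk : ∑ i ∈ S, g i * (y + t • d) i = 0 := by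
        have hdk : ∑ i ∈ S, g i * d i = 0 := by
          simp [hd, mul_sub, Finset.sum_sub_distrib, Pi.single_apply, hmem heS 0 c0,
            hmem heS 2 c2, mul_comm]
        simp only [Pi.add_apply, Pi.smul_apply, smul_eq_mul, mul_add, Finset.sum_add_distrib,
          hker, mul_left_comm _ t, ← Finset.mul_sum, hdk, mul_zero, add_zero]
      have h1 := weight_mul_ratio_eq hmono hnn hp he heS hg hz hmin ht hs hk c0 c1
      have h2 := weight_mul_ratio_eq hmono hnn hp he heS hg hz hmin hy hsupp hker c0 c1
      simp only [Pi.add_apply, Pi.smul_apply, smul_eq_mul, hd0, hd1, mul_zero, add_zero] at h1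
      have h3 := mul_right_cancel₀ (hρ 0 c0) (h1.trans h2.symm)
      rw [hw0, one_mul, one_mul] at h3
      exact (Real.rpow_left_inj (abs_nonneg _) (abs_nonneg _) (sub_ne_zero.2 hp2)).1 h3
    obtain ⟨t, ht0, ht1, ht2⟩ := ((hconst.filter_mono nhdsWithin_le_nhds).and
      ((eventually_add_mul_ne_zero 0 hg2).and
        (eventually_add_mul_ne_zero (2 * y (e 0)) hg2))).exists
    by_contra hp2
    rcases abs_eq_abs.1 (ht0 hp2) with h | h
    · exact ht1 (by linarith)
    · exact ht2 (by linarith)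
  subst hp2
  have hconst : ∀ {y : ℕ → ℝ} {e : ℕ → ℕ}, (∀ i ∉ S, y i = 0) → ∑ i ∈ S, g i * y i = 0 →
      Function.Injective e → (Finset.range S.card).image e = S → IsOrderedOn e S.card y →
      ∀ k < S.card, ∀ l < S.card, w k * (z (e k) / g (e k)) = w l * (z (e l) / g (e l)) := by
    intro y e hsupp hker he heS hy k hk l hl
    simpa using weight_mul_ratio_eq hmono hnn hp he heS hg hz hmin hy hsupp hker hk hl
  obtain ⟨m, hm, hmg⟩ := S.exists_min_image (fun i => |g i|) ⟨i₁, hi₁⟩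
  have hgm := hg m hm
  have hcard : (S.erase m).card = S.card - 1 := Finset.card_erase_of_mem hm
  -- A vector whose largest entry is at `m`.
  obtain ⟨e, heS, he0, heq⟩ : ∃ e : ℕ → ℕ, (Finset.range S.card).image e = S ∧ e 0 = m ∧
      ∀ k < S.card, ∀ l < S.card, w k * (z (e k) / g (e k)) = w l * (z (e l) / g (e l)) := by
    set y₀ : ℕ → ℝ := fun i => if i = m then -(∑ j ∈ S.erase m, |g j|) / g m else
      if i ∈ S then |g i| / g i else 0 with hy₀
    have hm0 : y₀ m = -(∑ j ∈ S.erase m, |g j|) / g m := if_pos rfl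
    have hj0 : ∀ j ∈ S.erase m, y₀ j = |g j| / g j := fun j hj => by
      simp [hy₀, Finset.ne_of_mem_erase hj, Finset.mem_of_mem_erase hj]
    obtain ⟨y, e, hQ, hsupp, hker, he, heS, hy⟩ := exists_isOrderedOn_of_eventually hS hg
      (y₀ := y₀)
      (fun i hi => by
        have h1 : i ≠ m := fun h => hi (h ▸ hm)
        simp [hy₀, h1, hi])
      (by
        rw [← Finset.add_sum_erase S _ hm, hm0, mul_div_cancel₀ _ hgm, ← sub_eq_neg_add,
          sub_eq_zero]
        refine Finset.sum_congr rfl fun j hj => ?_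
        rw [hj0 j hj, mul_div_cancel₀ _ (hg j (Finset.mem_of_mem_erase hj))])
      (Q := fun y => ∀ j ∈ S.erase m, |y j| < |y m|)
      (by
        rw [Filter.eventually_all_finset]
        intro j hj
        refine habs ?_
        have hgj := hg j (Finset.mem_of_mem_erase hj)
        rw [hj0 j hj, hm0, abs_div, abs_abs, div_self (abs_ne_zero.2 hgj), abs_div, abs_neg,
          abs_of_nonneg (Finset.sum_nonneg fun j _ => abs_nonneg (g j)),
          lt_div_iff₀ (abs_pos.2 hgm), one_mul]
        have h1 : (S.erase m).card • |g m| ≤ ∑ j ∈ S.erase m, |g j| :=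
          Finset.card_nsmul_le_sum _ _ _ fun j hj => hmg j (Finset.mem_of_mem_erase hj)
        have h2 : (2 : ℝ) ≤ (S.erase m).card := by
          rw [hcard]
          exact_mod_cast (by omega : 2 ≤ S.card - 1)
        rw [nsmul_eq_mul] at h1
        nlinarith [abs_pos.2 hgm])
    refine ⟨e, heS, ?_, hconst hsupp hker he heS hy⟩
    obtain ⟨k, hk, hek⟩ := hidx heS m hm
    by_contra hne
    have hk0 : 0 < k := Nat.pos_of_ne_zero fun h => hne (h ▸ hek)
    have h1 := hy.2 0 k hk0 hk
    rw [hek] at h1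
    exact lt_asymm h1 (hQ _ (Finset.mem_erase.2 ⟨hne, hmem heS 0 (by omega)⟩))
  -- A vector whose smallest entry is at `m`.
  obtain ⟨e', heS', he0', heq'⟩ : ∃ e : ℕ → ℕ, (Finset.range S.card).image e = S ∧
      e (S.card - 1) = m ∧
      ∀ k < S.card, ∀ l < S.card, w k * (z (e k) / g (e k)) = w l * (z (e l) / g (e l)) := by
    obtain ⟨j₀, hj₀⟩ : (S.erase m).Nonempty := Finset.card_pos.1 (by omega)
    have hgj₀ := hg j₀ (Finset.mem_of_mem_erase hj₀)
    have hcard' : ((S.erase m).erase j₀).card = S.card - 2 := by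
      rw [Finset.card_erase_of_mem hj₀, hcard]
      omega
    set y₀ : ℕ → ℝ := fun i => if i ∈ S.erase m then
      if i = j₀ then -((S.card - 2 : ℕ) : ℝ) / g j₀ else 1 / g i else 0 with hy₀
    have hm0 : y₀ m = 0 := by simp [hy₀]
    have hj0 : y₀ j₀ = -((S.card - 2 : ℕ) : ℝ) / g j₀ := by simp only [hy₀, if_pos hj₀, if_true]
    have hi0 : ∀ i ∈ (S.erase m).erase j₀, y₀ i = 1 / g i := fun i hi => by
      simp only [hy₀, if_pos (Finset.mem_of_mem_erase hi), if_neg (Finset.ne_of_mem_erase hi)]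
    obtain ⟨y, e, hQ, hsupp, hker, he, heS, hy⟩ := exists_isOrderedOn_of_eventually hS hg
      (y₀ := y₀) (fun i hi => if_neg fun h => hi (Finset.mem_of_mem_erase h))
      (by
        rw [← Finset.add_sum_erase S _ hm, hm0, mul_zero, zero_add,
          ← Finset.add_sum_erase _ _ hj₀, hj0, mul_div_cancel₀ _ hgj₀]
        have : ∀ i ∈ (S.erase m).erase j₀, g i * y₀ i = 1 := fun i hi => by
          rw [hi0 i hi, mul_div_cancel₀ _
            (hg i (Finset.mem_of_mem_erase (Finset.mem_of_mem_erase hi)))]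
        rw [Finset.sum_congr rfl this, Finset.sum_const, hcard']
        simp)
      (Q := fun y => ∀ j ∈ S.erase m, |y m| < |y j|)
      (by
        rw [Filter.eventually_all_finset]
        intro j hj
        refine habs ?_
        rw [hm0, abs_zero, abs_pos]
        by_cases hjj : j = j₀
        · rw [hjj, hj0]
          refine div_ne_zero (neg_ne_zero.2 ?_) hgj₀
          exact_mod_cast (by omega : S.card - 2 ≠ 0)
        · rw [hi0 j (Finset.mem_erase.2 ⟨hjj, hj⟩)]
          exact one_div_ne_zero (hg j (Finset.mem_of_mem_erase hj)))
    refine ⟨e, heS, ?_, hconst hsupp hker he heS hy⟩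
    obtain ⟨k, hk, hek⟩ := hidx heS m hm
    by_contra hne
    have hk0 : k < S.card - 1 :=
      lt_of_le_of_ne (by omega) fun h => hne (h ▸ hek)
    have h1 := hy.2 k (S.card - 1) hk0 (by omega)
    rw [hek] at h1
    exact lt_asymm h1 (hQ _ (Finset.mem_erase.2 ⟨hne, hmem heS _ (by omega)⟩))
  refine ⟨rfl, ?_⟩
  have c0 : 0 < S.card := by omega
  have hlast : S.card - 1 < S.card := by omega
  obtain ⟨k, hk, hek⟩ := hidx heS _ (hmem heS' 0 c0)
  have h1 := heq' 0 c0 _ hlast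
  have h2 := heq 0 c0 k hk
  rw [he0', hw0, one_mul] at h1
  rw [he0, hek, hw0, one_mul, h1, ← mul_assoc] at h2
  have h3 := mul_right_cancel₀ (hρ m hm) ((one_mul _).trans h2)
  have h4 : w k ≤ 1 := hw0 ▸ hmono (Nat.zero_le k)
  have h5 : w (S.card - 1) ≤ 1 := hw0 ▸ hmono (Nat.zero_le _)
  nlinarith [hnn k, hnn (S.card - 1)]

theorem lorentzSum_ne_top_of_support {w : ℕ → ℝ} (hmono : Antitone w) (hnn : ∀ n, 0 ≤ w n)
    {p : ℝ} (hp : 0 < p) (S : Finset ℕ) {y : ℕ → ℝ} (hy : ∀ i ∉ S, y i = 0) :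
    lorentzSum w p y ≠ ⊤ := by
  induction S using Finset.induction_on generalizing y with
  | empty =>
    have : y = 0 := funext fun i => hy i (Finset.notMem_empty i)
    simp [this, lorentzSum, Real.zero_rpow hp.ne']
  | insert a S ha ih =>
    have h1 : lorentzSum w p (Pi.single a (y a)) ≠ ⊤ := by
      refine ne_top_of_le_ne_top ENNReal.ofReal_ne_top
        (lorentzSum_le_of_ordered hmono hnn hp (add_left_injective a) 1
          (fun k l hkl hl => by omega) fun i hi => ?_)
      have : i ≠ a := fun h => hi (by simp [h])
      simp [this]
    have h2 : lorentzSum w p (Function.update y a 0) ≠ ⊤ := ih fun i hi => by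
      by_cases hia : i = a
      · simp [hia]
      · simpa [hia] using hy i (by simp [hia, hi])
    refine ne_top_of_le_ne_top (ENNReal.add_ne_top.2 ⟨h1, h2⟩)
      (lorentzSum_le_add hnn hp.le fun i => ?_)
    by_cases hia : i = a
    · simp [hia]
    · simp [hia]

/-- If `ker f` is the range of a norm-one projection on `ℓ_{w,p}` (`1 < p < ∞`,
`w₂ > 0`) and `card (supp f) ≥ N > 2`, then `p = 2` and `w₁ = … = w_N = 1`. -/
theorem stmt11 (p : ℝ) (hp : 1 < p)
    (w : ℕ → ℝ) (hmono : Antitone w) (hnn : ∀ n, 0 ≤ w n)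
    (hw0 : w 0 = 1) (hw1 : 0 < w 1)
    (g : ℕ → ℝ) (N : ℕ) (hN : 2 < N)
    (hsupp : ∃ s : Finset ℕ, s.card = N ∧ ∀ i ∈ s, g i ≠ 0)
    (P : (ℕ → ℝ) →ₗ[ℝ] (ℕ → ℝ))
    (hinto : ∀ x : ℕ → ℝ, lorentzSum w p x ≠ ⊤ →
      Summable (fun n => g n * P x n) ∧ ∑' n, g n * P x n = 0)
    (hfix : ∀ x : ℕ → ℝ, lorentzSum w p x ≠ ⊤ →
      Summable (fun n => g n * x n) → ∑' n, g n * x n = 0 → P x = x)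
    (hcontr : ∀ x, lorentzSum w p (P x) ≤ lorentzSum w p x) :
    p = 2 ∧ ∀ k < N, w k = 1 := by
  obtain ⟨s, hsN, hsg⟩ := hsupp
  have hp0 : 0 < p := by linarith
  obtain ⟨i₀, hi₀⟩ : s.Nonempty := Finset.card_pos.1 (by omega)
  set q : ℕ → ℝ := P (Pi.single i₀ 1)
  set z : ℕ → ℝ := Pi.single i₀ 1 - q with hzdef
  have hsingle : lorentzSum w p (Pi.single i₀ 1) ≠ ⊤ :=
    lorentzSum_ne_top_of_support hmono hnn hp0 {i₀} fun i hi => by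
      simp [show i ≠ i₀ by simpa using hi]
  have hq : lorentzSum w p q ≠ ⊤ := ne_top_of_le_ne_top hsingle (hcontr _)
  obtain ⟨hqs, hq0⟩ := hinto _ hsingle
  have hPz : P z = 0 := by
    rw [hzdef, map_sub, hfix q hq hqs hq0, sub_self]
  have hz : lorentzSum w p z ≠ ⊤ := by
    have h1 : lorentzSum w p (Pi.single i₀ (z i₀)) ≠ ⊤ :=
      lorentzSum_ne_top_of_support hmono hnn hp0 {i₀} fun i hi => by
        simp [show i ≠ i₀ by simpa using hi]
    refine ne_top_of_le_ne_top (ENNReal.add_ne_top.2 ⟨h1, hq⟩)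
      (lorentzSum_le_add hnn hp0.le fun i => ?_)
    by_cases hi : i = i₀
    · simp [hi]
    · simp [hzdef, hi]
  obtain ⟨i₁, hi₁⟩ : ∃ i, g i * z i ≠ 0 := by
    by_contra! h
    have hgq : ∀ i ≠ i₀, g i * q i = 0 := fun i hi => by simpa [hzdef, hi] using h i
    have h1 : g i₀ * q i₀ = 0 := (tsum_eq_single i₀ hgq).symm.trans hq0
    have h2 := h i₀
    simp only [hzdef, Pi.sub_apply, Pi.single_eq_same, mul_sub, h1, mul_one, sub_zero] at h2
    exact hsg i₀ hi₀ h2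
  have hcard : N ≤ (insert i₁ s).card := hsN ▸ Finset.card_le_card (Finset.subset_insert i₁ s)
  have hmin : ∀ y : ℕ → ℝ, (∀ i ∉ insert i₁ s, y i = 0) → ∑ i ∈ insert i₁ s, g i * y i = 0 →
      ∀ t : ℝ, lorentzSum w p y ≤ lorentzSum w p (y + t • z) := by
    intro y hy hker t
    have hy0 : ∀ i ∉ insert i₁ s, g i * y i = 0 := fun i hi => by rw [hy i hi, mul_zero]
    have hPy : P y = y := hfix y (lorentzSum_ne_top_of_support hmono hnn hp0 _ hy)
      (summable_of_ne_finset_zero hy0) ((tsum_eq_sum hy0).trans hker)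
    have h := hcontr (y + t • z)
    rwa [map_add, map_smul, hPz, hPy, smul_zero, add_zero] at h
  obtain ⟨hp2, hw⟩ := eq_two_and_weight_eq_one hmono hnn hw0 hw1 hp (by omega)
    (fun i hi => (Finset.mem_insert.1 hi).elim (fun h => h ▸ left_ne_zero_of_mul hi₁) (hsg i))
    hz hmin (Finset.mem_insert_self i₁ s) (right_ne_zero_of_mul hi₁)
  refine ⟨hp2, fun k hk => le_antisymm (hw0 ▸ hmono (Nat.zero_le k)) ?_⟩
  rw [← hw]
  exact hmono (by omega)
end

section
/- Let ℓ_{w,p} be a Lorentz sequence space with 1 < p < ∞ and wᵢ > 0 for all i ≥ 1. If there exists a functional f with card(supp f) > 2 such that ker f is the range of a norm-one projection on ℓ_{w,p}, then ℓ_{w,p} = ℓ₂ isometrically, i.e., p = 2 and wᵢ = 1 for all i. -/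
open ENNReal

/-! ### Rearrangement -/

lemma Antitone.sum_le_sum_range_card {a : ℕ → ℝ} (ha : Antitone a) (s : Finset ℕ) :
    ∑ i ∈ s, a i ≤ ∑ i ∈ Finset.range s.card, a i := by
  induction s using Finset.induction_on_max with
  | empty => simp
  | insert M s hM ih =>
    have hMs : M ∉ s := fun h => lt_irrefl _ (hM M h)
    have hcard : s.card ≤ M := by
      simpa using Finset.card_le_card (fun x hx => Finset.mem_range.2 (hM x hx) :
        s ⊆ Finset.range M)
    rw [Finset.sum_insert hMs, Finset.card_insert_of_notMem hMs, Finset.sum_range_succ]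
    linarith [ha hcard]

lemma Antitone.sum_mul_nonpos {w d : ℕ → ℝ} (hw : Antitone w) (hpos : ∀ n, 0 < w n)
    (hd : ∀ N, ∑ n ∈ Finset.range N, d n ≤ 0) (N : ℕ) :
    ∑ n ∈ Finset.range N, w n * d n ≤ 0 := by
  have key : ∀ N, ∑ n ∈ Finset.range (N + 1), w n * d n ≤
      w N * ∑ n ∈ Finset.range (N + 1), d n := by
    intro N
    induction N with
    | zero => simp
    | succ N ih =>
      rw [Finset.sum_range_succ, Finset.sum_range_succ (fun n => d n) (N + 1), mul_add]
      have := mul_le_mul_of_nonpos_right (hw N.le_succ) (hd (N + 1))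
      simp only [Nat.succ_eq_add_one] at this
      linarith
  cases N with
  | zero => simp
  | succ N => exact (key N).trans (mul_nonpos_of_nonneg_of_nonpos (hpos N).le (hd _))

lemma Antitone.sum_mul_comp_le {w a : ℕ → ℝ} (hw : Antitone w) (hpos : ∀ n, 0 < w n)
    (ha : Antitone a) {π : ℕ → ℕ} (hπ : Function.Injective π) (N : ℕ) :
    ∑ n ∈ Finset.range N, w n * a (π n) ≤ ∑ n ∈ Finset.range N, w n * a n := by
  have := hw.sum_mul_nonpos hpos (d := fun n => a (π n) - a n) (fun N => ?_) N
  · simpa [mul_sub, Finset.sum_sub_distrib] using this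
  · have h := ha.sum_le_sum_range_card ((Finset.range N).image π)
    rw [Finset.sum_image hπ.injOn, Finset.card_image_of_injective _ hπ, Finset.card_range] at h
    simpa [Finset.sum_sub_distrib] using h

/-! ### Basic estimates for `lorentzSum` -/

lemma tsum_le_lorentzSum (w : ℕ → ℝ) (p : ℝ) (x : ℕ → ℝ) (σ : Equiv.Perm ℕ) :
    ∑' n, ENNReal.ofReal (w n * |x (σ n)| ^ p) ≤ lorentzSum w p x :=
  le_iSup (fun π : {g : ℕ → ℕ // Function.Injective g} =>
    ∑' n, ENNReal.ofReal (w n * |x (π.1 n)| ^ p)) ⟨σ, σ.injective⟩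

lemma lorentzSum_le_tsum {p : ℝ} (hp : 1 < p) {w : ℕ → ℝ} (hw : Antitone w)
    (hpos : ∀ n, 0 < w n) (x : ℕ → ℝ) (σ : Equiv.Perm ℕ) (hx : Antitone fun n => |x (σ n)|) :
    lorentzSum w p x ≤ ∑' n, ENNReal.ofReal (w n * |x (σ n)| ^ p) := by
  refine iSup_le fun π => ENNReal.tsum_le_of_sum_range_le fun N => ?_
  have hnn : ∀ (τ : ℕ → ℕ), ∀ n ∈ Finset.range N, 0 ≤ w n * |x (τ n)| ^ p := fun τ n _ =>
    mul_nonneg (hpos n).le (Real.rpow_nonneg (abs_nonneg _) _)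
  refine le_trans ?_ (ENNReal.sum_le_tsum (Finset.range N))
  rw [← ENNReal.ofReal_sum_of_nonneg (hnn π.1), ← ENNReal.ofReal_sum_of_nonneg (hnn σ)]
  apply ENNReal.ofReal_le_ofReal
  have ha : Antitone fun n => |x (σ n)| ^ p := fun m n hmn =>
    Real.rpow_le_rpow (abs_nonneg _) (hx hmn) (by linarith)
  simpa using hw.sum_mul_comp_le hpos ha (σ.symm.injective.comp π.2) N

/-- Comparison of `lorentzSum` from a pointwise comparison of `p`-th powers. -/
lemma lorentzSum_le_of_abs_rpow_le {p : ℝ} {w : ℕ → ℝ} (hpos : ∀ n, 0 < w n)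
    {x y z : ℕ → ℝ} {C : ℝ} (hC : 0 ≤ C)
    (h : ∀ n, |x n| ^ p ≤ |y n| ^ p + C * |z n| ^ p) :
    lorentzSum w p x ≤ lorentzSum w p y + ENNReal.ofReal C * lorentzSum w p z := by
  refine iSup_le fun π => ?_
  calc ∑' n, ENNReal.ofReal (w n * |x (π.1 n)| ^ p)
      ≤ ∑' n, (ENNReal.ofReal (w n * |y (π.1 n)| ^ p) +
          ENNReal.ofReal C * ENNReal.ofReal (w n * |z (π.1 n)| ^ p)) := by
        refine ENNReal.tsum_le_tsum fun n => ?_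
        have hy := mul_nonneg (hpos n).le (Real.rpow_nonneg (abs_nonneg (y (π.1 n))) p)
        have hz := mul_nonneg (hpos n).le (Real.rpow_nonneg (abs_nonneg (z (π.1 n))) p)
        rw [← ENNReal.ofReal_mul hC, ← ENNReal.ofReal_add hy (mul_nonneg hC hz)]
        apply ENNReal.ofReal_le_ofReal
        have := mul_le_mul_of_nonneg_left (h (π.1 n)) (hpos n).le
        linarith
    _ = ∑' n, ENNReal.ofReal (w n * |y (π.1 n)| ^ p) +
          ENNReal.ofReal C * ∑' n, ENNReal.ofReal (w n * |z (π.1 n)| ^ p) := by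
        rw [ENNReal.tsum_add, ENNReal.tsum_mul_left]
    _ ≤ _ := by
        gcongr
        · exact le_iSup (fun π : {g : ℕ → ℕ // Function.Injective g} =>
            ∑' n, ENNReal.ofReal (w n * |y (π.1 n)| ^ p)) π
        · exact le_iSup (fun π : {g : ℕ → ℕ // Function.Injective g} =>
            ∑' n, ENNReal.ofReal (w n * |z (π.1 n)| ^ p)) π

lemma abs_sub_rpow_le {p : ℝ} (hp : 1 < p) (a b : ℝ) :
    |a - b| ^ p ≤ 2 ^ p * (|a| ^ p + |b| ^ p) := by
  have hp0 : 0 ≤ p := by linarith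
  have ha := Real.rpow_nonneg (abs_nonneg a) p
  have hb := Real.rpow_nonneg (abs_nonneg b) p
  have key : |a - b| ^ p ≤ (2 * max |a| |b|) ^ p := by
    apply Real.rpow_le_rpow (abs_nonneg _) _ hp0
    linarith [abs_sub a b, le_max_left |a| |b|, le_max_right |a| |b|]
  rw [Real.mul_rpow two_pos.le (le_max_of_le_left (abs_nonneg _))] at key
  refine key.trans (mul_le_mul_of_nonneg_left ?_ (by positivity))
  rcases max_choice |a| |b| with h | h <;> rw [h] <;> linarith

lemma lorentzSum_zero {p : ℝ} (hp : 1 < p) (w : ℕ → ℝ) : lorentzSum w p 0 = 0 := by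
  simp [lorentzSum, Real.zero_rpow (by linarith : p ≠ 0)]

lemma lorentzSum_sub_ne_top {p : ℝ} (hp : 1 < p) {w : ℕ → ℝ} (hpos : ∀ n, 0 < w n)
    {x y : ℕ → ℝ} (hx : lorentzSum w p x ≠ ⊤) (hy : lorentzSum w p y ≠ ⊤) :
    lorentzSum w p (x - y) ≠ ⊤ := by
  have hC : (0 : ℝ) ≤ 2 ^ p := by positivity
  have h1 : lorentzSum w p (x - y) ≤
      lorentzSum w p (fun n => 2 * |x n|) + ENNReal.ofReal (2 ^ p) * lorentzSum w p y := by
    refine lorentzSum_le_of_abs_rpow_le hpos hC fun n => ?_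
    rw [abs_mul, abs_abs, Real.mul_rpow (abs_nonneg _) (abs_nonneg _), abs_two, ← mul_add]
    exact abs_sub_rpow_le hp _ _
  have h2 : lorentzSum w p (fun n => 2 * |x n|) ≤
      lorentzSum w p 0 + ENNReal.ofReal (2 ^ p) * lorentzSum w p x := by
    refine lorentzSum_le_of_abs_rpow_le hpos hC fun n => ?_
    rw [abs_mul, abs_abs, Real.mul_rpow (abs_nonneg _) (abs_nonneg _), abs_two]
    exact le_add_of_nonneg_left (Real.rpow_nonneg (abs_nonneg _) _)
  rw [lorentzSum_zero hp, zero_add] at h2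
  exact ne_top_of_le_ne_top (ENNReal.add_ne_top.2
    ⟨ne_top_of_le_ne_top (ENNReal.mul_ne_top ENNReal.ofReal_ne_top hx) h2,
      ENNReal.mul_ne_top ENNReal.ofReal_ne_top hy⟩) h1

/-- `lorentzSum` of a finitely supported sequence whose moduli decrease along `σ`. -/
lemma lorentzSum_eq_sum {p : ℝ} (hp : 1 < p) {w : ℕ → ℝ} (hw : Antitone w)
    (hpos : ∀ n, 0 < w n) (σ : Equiv.Perm ℕ) {M : ℕ} {z : ℕ → ℝ}
    (hz : ∀ n, n + 1 < M → |z (n + 1)| ≤ |z n|) (hz0 : ∀ n, M ≤ n → z n = 0) :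
    lorentzSum w p (z ∘ σ.symm) =
      ENNReal.ofReal (∑ n ∈ Finset.range M, w n * |z n| ^ p) := by
  have hanti : Antitone fun n => |z n| := by
    refine antitone_nat_of_succ_le fun n => ?_
    by_cases h : n + 1 < M
    · exact hz n h
    · simp [hz0 (n + 1) (by omega)]
  have hsum : ∑' n, ENNReal.ofReal (w n * |(z ∘ σ.symm) (σ n)| ^ p) =
      ENNReal.ofReal (∑ n ∈ Finset.range M, w n * |z n| ^ p) := by
    rw [ENNReal.ofReal_sum_of_nonneg fun n _ =>
      mul_nonneg (hpos n).le (Real.rpow_nonneg (abs_nonneg _) _)]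
    rw [tsum_eq_sum (s := Finset.range M)]
    · simp
    · intro n hn
      simp [hz0 n (by simpa using hn), Real.zero_rpow (by linarith : p ≠ 0)]
  refine le_antisymm ?_ ?_
  · rw [← hsum]
    exact lorentzSum_le_tsum hp hw hpos _ σ (by simpa using hanti)
  · rw [← hsum]
    exact tsum_le_lorentzSum w p _ σ

lemma lorentzSum_single_ne_top {p : ℝ} (hp : 1 < p) {w : ℕ → ℝ} (hw : Antitone w)
    (hpos : ∀ n, 0 < w n) (i : ℕ) : lorentzSum w p (Pi.single i 1) ≠ ⊤ := by
  have h := lorentzSum_eq_sum hp hw hpos (Equiv.swap 0 i) (M := 1) (z := Pi.single 0 1)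
    (by simp) (fun n hn => by simp [show n ≠ 0 by omega])
  have : (Pi.single 0 1 : ℕ → ℝ) ∘ (Equiv.swap 0 i).symm = Pi.single i 1 := by
    ext n
    simp only [Function.comp, Equiv.symm_swap, Pi.single_apply, Equiv.swap_apply_eq_iff,
      Equiv.swap_apply_left]
  rw [this] at h
  simp [h]

/-- If `‖y‖ ≤ ‖y + t v‖` for all `t`, then the derivative of the norm at `y` vanishes at `v`. -/
lemma sum_mul_eq_zero_of_lorentzSum_le {p : ℝ} (hp : 1 < p) {w : ℕ → ℝ} (hw : Antitone w)
    (hpos : ∀ n, 0 < w n) {v : ℕ → ℝ} (hv : lorentzSum w p v ≠ ⊤) (σ : Equiv.Perm ℕ) {M : ℕ}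
    {z : ℕ → ℝ} (hz : ∀ n, n + 1 < M → |z (n + 1)| < |z n|) (hz0 : ∀ n, M ≤ n → z n = 0)
    (h : ∀ t : ℝ, lorentzSum w p (z ∘ σ.symm) ≤ lorentzSum w p (z ∘ σ.symm + t • v)) :
    ∑ n ∈ Finset.range M, w n * (|z n| ^ (p - 2) * z n * v (σ n)) = 0 := by
  set C := (lorentzSum w p v).toReal
  have hp0 : p ≠ 0 := by linarith
  let f : ℝ → ℝ := fun t => ∑ n ∈ Finset.range M, w n * |z n + t * v (σ n)| ^ p + |t| ^ p * C
  have hmin : IsLocalMin f 0 := by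
    have hev : ∀ᶠ t in nhds (0 : ℝ), ∀ n ∈ Finset.range M, n + 1 < M →
        |z (n + 1) + t * v (σ (n + 1))| < |z n + t * v (σ n)| := by
      rw [Filter.eventually_all_finset]
      intro n _
      by_cases hn : n + 1 < M
      · have c1 : Continuous fun t : ℝ => |z (n + 1) + t * v (σ (n + 1))| := by fun_prop
        have c2 : Continuous fun t : ℝ => |z n + t * v (σ n)| := by fun_prop
        filter_upwards [c1.continuousAt.eventually_lt c2.continuousAt (by simpa using hz n hn)]
          with t ht _ using ht
      · simp [hn]
    filter_upwards [hev] with t ht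
    let u : ℕ → ℝ := fun n => if n < M then z n + t * v (σ n) else 0
    have hu := lorentzSum_eq_sum hp hw hpos σ (M := M) (z := u)
      (fun n hn => by
        simpa [u, hn, show n < M by omega] using (ht n (by simp; omega) hn).le)
      (fun n hn => by simp [u, hn])
    have hle : lorentzSum w p (z ∘ σ.symm + t • v) ≤
        lorentzSum w p (u ∘ σ.symm) + ENNReal.ofReal (|t| ^ p) * lorentzSum w p v := by
      refine lorentzSum_le_of_abs_rpow_le hpos (by positivity) fun n => ?_
      rw [← Real.mul_rpow (abs_nonneg _) (abs_nonneg _), ← abs_mul]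
      by_cases hn : σ.symm n < M
      · simp only [u, Pi.add_apply, Function.comp, Pi.smul_apply, smul_eq_mul, hn, if_true,
          Equiv.apply_symm_apply]
        exact le_add_of_nonneg_right (by positivity)
      · simp [u, hn, hz0 _ (not_lt.1 hn), Real.zero_rpow hp0]
    have hfin := (h t).trans hle
    have hnn : 0 ≤ ∑ n ∈ Finset.range M, w n * |u n| ^ p :=
      Finset.sum_nonneg fun n _ => mul_nonneg (hpos n).le (by positivity)
    rw [lorentzSum_eq_sum hp hw hpos σ (fun n hn => (hz n hn).le) hz0, hu,
      ← ENNReal.ofReal_toReal hv, ← ENNReal.ofReal_mul (by positivity),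
      ← ENNReal.ofReal_add hnn (by positivity),
      ENNReal.ofReal_le_ofReal_iff (by positivity)] at hfin
    have hsum : ∑ n ∈ Finset.range M, w n * |u n| ^ p =
        ∑ n ∈ Finset.range M, w n * |z n + t * v (σ n)| ^ p :=
      Finset.sum_congr rfl fun n hn => by simp [u, Finset.mem_range.1 hn]
    simpa [f, Real.zero_rpow hp0, ← hsum] using hfin
  have hder : HasDerivAt f (∑ n ∈ Finset.range M,
      w n * (p * |z n + 0 * v (σ n)| ^ (p - 2) * (z n + 0 * v (σ n)) * (1 * v (σ n))) +
      p * |(0 : ℝ)| ^ (p - 2) * 0 * C) 0 := by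
    refine HasDerivAt.add (HasDerivAt.fun_sum fun n _ => ?_)
      ((hasDerivAt_abs_rpow 0 hp).mul_const C)
    exact ((hasDerivAt_abs_rpow _ hp).comp (0 : ℝ)
      (((hasDerivAt_id (0 : ℝ)).mul_const (v (σ n))).const_add (z n))).const_mul (w n)
  have hzero := hmin.hasDerivAt_eq_zero hder
  have hfac : p * ∑ n ∈ Finset.range M, w n * (|z n| ^ (p - 2) * z n * v (σ n)) = 0 := by
    rw [← hzero, Finset.mul_sum]
    simp only [zero_mul, add_zero, mul_zero, one_mul]
    exact Finset.sum_congr rfl fun n _ => by ring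
  exact (mul_eq_zero.1 hfac).resolve_left hp0

/-! ### Consequences of the orthogonality relations -/

lemma exists_perm_apply_eq {α : Type*} {i j k a b c : α} (hij : i ≠ j) (hik : i ≠ k)
    (hjk : j ≠ k) (hab : a ≠ b) (hac : a ≠ c) (hbc : b ≠ c) :
    ∃ σ : Equiv.Perm α, σ i = a ∧ σ j = b ∧ σ k = c := by
  have hinj : ∀ {x y z : α}, x ≠ y → x ≠ z → y ≠ z → Function.Injective ![x, y, z] := by
    intro x y z hxy hxz hyz s t hst
    fin_cases s <;> fin_cases t <;> simp_all [eq_comm]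
  obtain ⟨σ, hσ⟩ := (Equiv.Perm.isMultiplyPretransitive α 3).exists_smul_eq
    ⟨_, hinj hij hik hjk⟩ ⟨_, hinj hab hac hbc⟩
  exact ⟨σ, by simpa using DFunLike.congr_fun hσ 0, by simpa using DFunLike.congr_fun hσ 1,
    by simpa using DFunLike.congr_fun hσ 2⟩

lemma abs_rpow_sub_two_mul_self {ε x p : ℝ} (hε : |ε| = 1) (hx : 0 < x) :
    |ε * x| ^ (p - 2) * (ε * x) = ε * x ^ (p - 1) := by
  rw [abs_mul, hε, one_mul, abs_of_pos hx, show p - 1 = p - 2 + 1 by ring,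
    Real.rpow_add_one hx.ne']
  ring

/-- Testing the orthogonality relations on vectors whose largest entry is at `c` and whose
smallest nonzero entry, of size `s` and rank `m`, is at `a`. -/
lemma exists_forall_add_rpow_eq {p : ℝ} {w g v : ℕ → ℝ}
    (H : ∀ (σ : Equiv.Perm ℕ) (M : ℕ) (z : ℕ → ℝ), (∀ n, n + 1 < M → |z (n + 1)| < |z n|) →
      (∀ n, M ≤ n → z n = 0) → ∑ n ∈ Finset.range M, g (σ n) * z n = 0 →
      ∑ n ∈ Finset.range M, w n * (|z n| ^ (p - 2) * z n * v (σ n)) = 0)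
    {a b c : ℕ} (hab : a ≠ b) (hac : a ≠ c) (hbc : b ≠ c) (ha : g a ≠ 0) (hc : g c ≠ 0)
    (hcb : |g c| ≤ |g b|) {m : ℕ} (hm : 2 ≤ m) :
    ∃ K α : ℝ, 0 < α ∧ ∀ s : ℝ, 0 < s → s < 2 →
      K + w m * (|g a| * (v a / g a)) * s ^ (p - 1) =
        w 0 * (|g c| * (v c / g c)) * (α + |g a| / |g c| * s) ^ (p - 1) := by
  obtain ⟨k, rfl⟩ : ∃ k, m = k + 2 := ⟨m - 2, by omega⟩
  obtain ⟨σ, h0, h1, h2⟩ := exists_perm_apply_eq (i := 0) (j := 1) (k := k + 2)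
    (by omega) (by omega) (by omega) hbc.symm hac.symm hab.symm
  have hga := abs_pos.2 ha
  have hgc := abs_pos.2 hc
  let ε : ℕ → ℝ := fun n => if g n < 0 then -1 else 1
  have hε : ∀ n, |ε n| = 1 := fun n => by by_cases h : g n < 0 <;> simp [ε, h]
  have hεg : ∀ n, g n * ε n = |g n| := fun n => by
    by_cases h : g n < 0
    · simp [ε, h, abs_of_neg h]
    · simp [ε, h, abs_of_nonneg (not_lt.1 h)]
  have hεv : ∀ n, g n ≠ 0 → |g n| * (v n / g n) = ε n * v n := fun n hn => by
    rw [← hεg]; field_simp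
  have hkpos : ∀ j ∈ Finset.range (k + 1), (0 : ℝ) < k + 2 - j := fun j hj => by
    have : (j : ℝ) < k + 1 := by exact_mod_cast Finset.mem_range.1 hj
    linarith
  set K' : ℝ := ∑ j ∈ Finset.range (k + 1), |g (σ (j + 1))| * (k + 2 - j) with hK'
  have hK'le : |g b| * (k + 2) ≤ K' := by
    have := Finset.single_le_sum (f := fun j : ℕ => |g (σ (j + 1))| * ((k : ℝ) + 2 - j))
      (fun j hj => mul_nonneg (abs_nonneg _) (hkpos j hj).le)
      (Finset.mem_range.2 k.succ_pos : 0 ∈ Finset.range (k + 1))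
    simpa [h1] using this
  have hK'c : |g c| * (k + 2) ≤ K' :=
    (mul_le_mul_of_nonneg_right hcb (by positivity)).trans hK'le
  have hK'pos : 0 < K' := lt_of_lt_of_le (by positivity) hK'c
  refine ⟨∑ j ∈ Finset.range (k + 1),
    w (j + 1) * (ε (σ (j + 1)) * ((k : ℝ) + 2 - j) ^ (p - 1) * v (σ (j + 1))),
    K' / |g c|, by positivity, fun s hs hs2 => ?_⟩
  set X : ℝ := K' / |g c| + |g a| / |g c| * s with hX
  have hXpos : 0 < X := by positivity
  have hXc : |g c| * X = K' + |g a| * s := by rw [hX]; field_simp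
  have hXk : (k : ℝ) + 2 < X := by
    refine lt_of_mul_lt_mul_left ?_ hgc.le
    rw [hXc]
    have : 0 < |g a| * s := by positivity
    linarith
  let z : ℕ → ℝ := fun n =>
    if n = 0 then -(ε c * X)
    else if n < k + 2 then ε (σ n) * (k + 3 - n)
    else if n = k + 2 then ε a * s else 0
  have hz0 : z 0 = -(ε c * X) := by simp [z]
  have hzmid : ∀ j, j < k + 1 → z (j + 1) = ε (σ (j + 1)) * (k + 2 - j) := fun j hj => by
    simp only [z, Nat.succ_ne_zero, if_false, show j + 1 < k + 2 by omega, if_true]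
    push_cast
    ring
  have hzlast : z (k + 2) = ε a * s := by simp [z]
  have hdec : ∀ n, n + 1 < k + 3 → |z (n + 1)| < |z n| := by
    rintro (_ | n) hn
    · rw [hz0, hzmid 0 (by omega), abs_neg, abs_mul, abs_mul, hε, hε, abs_of_pos hXpos,
        Nat.cast_zero, sub_zero, abs_of_pos (by positivity)]
      linarith
    · have hn1 := hkpos n (Finset.mem_range.2 (by omega))
      rw [hzmid n (by omega), abs_mul, hε, abs_of_pos hn1]
      rcases Nat.lt_or_ge (n + 1) (k + 1) with h | h
      · have hn2 := hkpos (n + 1) (Finset.mem_range.2 h)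
        rw [hzmid (n + 1) h, abs_mul, hε, abs_of_pos hn2]
        push_cast
        linarith
      · obtain rfl : n = k := by omega
        rw [hzlast, abs_mul, hε, abs_of_pos hs]
        linarith
  have hker : ∑ n ∈ Finset.range (k + 3), g (σ n) * z n = 0 := by
    rw [Finset.sum_range_succ, Finset.sum_range_succ', h0, h2, hz0, hzlast,
      Finset.sum_congr rfl fun j hj => by
        rw [hzmid j (Finset.mem_range.1 hj), ← mul_assoc, hεg], ← hK']
    linear_combination s * hεg a - X * hεg c - hXc
  have hH := H σ (k + 3) z hdec (fun n hn => by
    simp [z, show n ≠ 0 by omega, show ¬ n < k + 2 by omega, show n ≠ k + 2 by omega]) hker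
  rw [Finset.sum_range_succ, Finset.sum_range_succ', h0, h2, hz0, hzlast,
    Finset.sum_congr rfl fun j hj => by
      rw [hzmid j (Finset.mem_range.1 hj), abs_rpow_sub_two_mul_self (hε _) (hkpos j hj)],
    abs_rpow_sub_two_mul_self (hε _) hs, ← neg_mul,
    abs_rpow_sub_two_mul_self (by rw [abs_neg, hε]) hXpos] at hH
  rw [hεv a ha, hεv c hc]
  linear_combination hH

lemma eq_zero_of_add_mul_rpow_eq {q K A C α β : ℝ} (hq : 0 < q) (hq1 : q ≠ 1) (hα : 0 < α)
    (hβ : 0 < β)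
    (h : ∀ s : ℝ, 0 < s → s < 2 → K + A * s ^ q = C * (α + β * s) ^ q) : A = 0 ∧ C = 0 := by
  have hder : ∀ s : ℝ, 0 < s → s < 2 →
      A * s ^ (q - 1) = C * β * (α + β * s) ^ (q - 1) := by
    intro s hs hs2
    have hpos : 0 < α + β * s := by positivity
    have d1 : HasDerivAt (fun s : ℝ => K + A * s ^ q) (A * (q * s ^ (q - 1))) s :=
      ((Real.hasDerivAt_rpow_const (Or.inl hs.ne')).const_mul A).const_add K
    have d2 : HasDerivAt (fun s : ℝ => C * (α + β * s) ^ q)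
        (C * (β * 1 * q * (α + β * s) ^ (q - 1))) s :=
      ((((hasDerivAt_id s).const_mul β).const_add α).rpow_const (Or.inl hpos.ne')).const_mul C
    have heq : (fun s : ℝ => K + A * s ^ q) =ᶠ[nhds s] fun s => C * (α + β * s) ^ q := by
      filter_upwards [Ioo_mem_nhds hs hs2] with t ht using h t ht.1 ht.2
    have := (d2.congr_of_eventuallyEq heq).unique d1
    refine mul_left_cancel₀ hq.ne' ?_
    linear_combination -this
  have hratio : ∀ s : ℝ, 0 < s → s < 2 → A = C * β * ((α + β * s) / s) ^ (q - 1) := by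
    intro s hs hs2
    rw [Real.div_rpow (by positivity) hs.le, ← mul_div_assoc, ← hder s hs hs2,
      mul_div_assoc, div_self (Real.rpow_pos_of_pos hs _).ne', mul_one]
  have hC : C = 0 := by
    by_contra hC
    have h1 := hratio 1 one_pos one_lt_two
    rw [hratio (1 / 2) (by norm_num) (by norm_num)] at h1
    have h2 := mul_left_cancel₀ (mul_ne_zero hC hβ.ne') h1
    rw [Real.rpow_left_inj (by positivity) (by positivity) (sub_ne_zero.2 hq1)] at h2
    linarith
  exact ⟨by simpa [hC] using hratio 1 one_pos one_lt_two, hC⟩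

/-- The orthogonality relations for three indices `a`, `b`, `c` with `|g c| ≤ |g b| ≤ |g a|`. -/
lemma eq_two_and_weight_eq_one_of_abs_le {p : ℝ} (hp : 1 < p) {w g v : ℕ → ℝ}
    (hmono : Antitone w) (hw0 : w 0 = 1) (hpos : ∀ n, 0 < w n)
    (H : ∀ (σ : Equiv.Perm ℕ) (M : ℕ) (z : ℕ → ℝ), (∀ n, n + 1 < M → |z (n + 1)| < |z n|) →
      (∀ n, M ≤ n → z n = 0) → ∑ n ∈ Finset.range M, g (σ n) * z n = 0 →
      ∑ n ∈ Finset.range M, w n * (|z n| ^ (p - 2) * z n * v (σ n)) = 0)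
    {a b c : ℕ} (hab : a ≠ b) (hac : a ≠ c) (hbc : b ≠ c) (ha : g a ≠ 0) (hb : g b ≠ 0)
    (hc : g c ≠ 0) (hcb : |g c| ≤ |g b|) (hba : |g b| ≤ |g a|)
    (hv : v a ≠ 0 ∨ v b ≠ 0 ∨ v c ≠ 0) : p = 2 ∧ ∀ n, w n = 1 := by
  have hga := abs_pos.2 ha
  have hgb := abs_pos.2 hb
  have hgc := abs_pos.2 hc
  have hcoef : ∀ {n j : ℕ}, g j ≠ 0 → w n * (|g j| * (v j / g j)) = 0 → v j = 0 := by
    intro n j hj h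
    simpa [(hpos n).ne', hj] using h
  have hp2 : p = 2 := by
    by_contra hp2
    have hq : 0 < p - 1 := by linarith
    have hq1 : p - 1 ≠ 1 := fun h => hp2 (by linarith)
    obtain ⟨K, α, hα, hK⟩ := exists_forall_add_rpow_eq H hab hac hbc ha hc hcb le_rfl
    obtain ⟨K', α', hα', hK'⟩ :=
      exists_forall_add_rpow_eq H hab.symm hbc hac hb hc (hcb.trans hba) le_rfl
    have h1 := eq_zero_of_add_mul_rpow_eq hq hq1 hα (by positivity) hK
    have h2 := eq_zero_of_add_mul_rpow_eq hq hq1 hα' (by positivity) hK'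
    rcases hv with h | h | h
    · exact h (hcoef ha h1.1)
    · exact h (hcoef hb h2.1)
    · exact h (hcoef hc h1.2)
  subst hp2
  -- comparing the slopes in `s` of both sides
  have slope : ∀ {i j : ℕ} {m : ℕ}, g i ≠ 0 → g j ≠ 0 →
      (∃ K α : ℝ, 0 < α ∧ ∀ s : ℝ, 0 < s → s < 2 →
        K + w m * (|g i| * (v i / g i)) * s ^ ((2 : ℝ) - 1) =
          w 0 * (|g j| * (v j / g j)) * (α + |g i| / |g j| * s) ^ ((2 : ℝ) - 1)) →
      w m * (v i / g i) = v j / g j := by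
    rintro i j m hi hj ⟨K, α, -, hK⟩
    have hgi := abs_pos.2 hi
    have hgj := abs_pos.2 hj
    have e1 := hK 1 one_pos one_lt_two
    have e2 := hK (1 / 2) (by norm_num) (by norm_num)
    norm_num only [Real.rpow_one, hw0] at e1 e2
    have e3 : |g j| * (v j / g j) * (|g i| / |g j|) = |g i| * (v j / g j) := by
      field_simp
    refine mul_left_cancel₀ hgi.ne' ?_
    linear_combination 2 * (e1 - e2) + e3
  have hw2 : ∀ m, 2 ≤ m → w m = 1 := by
    intro m hm
    have h1 := slope ha hc (exists_forall_add_rpow_eq H hab hac hbc ha hc hcb hm)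
    have h2 := slope hb hc
      (exists_forall_add_rpow_eq H hab.symm hbc hac hb hc (hcb.trans hba) hm)
    have h3 := slope hc hb (exists_forall_add_rpow_eq H hac.symm hbc.symm hab hc hb hba hm)
    have hrc : v c / g c ≠ 0 := by
      intro h
      rw [h] at h1 h2
      have hva : v a = 0 := by simpa [(hpos m).ne', ha] using h1
      have hvb : v b = 0 := by simpa [(hpos m).ne', hb] using h2
      have hvc : v c = 0 := by simpa [hc] using h
      tauto
    have hsq : w m * w m = 1 := by
      refine mul_right_cancel₀ hrc ?_
      linear_combination w m * h3 + h2
    nlinarith [hpos m]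
  refine ⟨rfl, fun n => ?_⟩
  rcases Nat.lt_or_ge n 2 with hn | hn
  · have h1 := hmono n.zero_le
    have h2 := hmono hn.le
    rw [hw2 2 le_rfl] at h2
    linarith
  · exact hw2 n hn

/-- The orthogonality relations for three indices. -/
lemma eq_two_and_weight_eq_one_s12 {p : ℝ} (hp : 1 < p) {w g v : ℕ → ℝ}
    (hmono : Antitone w) (hw0 : w 0 = 1) (hpos : ∀ n, 0 < w n)
    (H : ∀ (σ : Equiv.Perm ℕ) (M : ℕ) (z : ℕ → ℝ), (∀ n, n + 1 < M → |z (n + 1)| < |z n|) →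
      (∀ n, M ≤ n → z n = 0) → ∑ n ∈ Finset.range M, g (σ n) * z n = 0 →
      ∑ n ∈ Finset.range M, w n * (|z n| ^ (p - 2) * z n * v (σ n)) = 0)
    {a b c : ℕ} (hab : a ≠ b) (hac : a ≠ c) (hbc : b ≠ c) (ha : g a ≠ 0) (hb : g b ≠ 0)
    (hc : g c ≠ 0) (hv : v a ≠ 0 ∨ v b ≠ 0 ∨ v c ≠ 0) : p = 2 ∧ ∀ n, w n = 1 := by
  have main := @eq_two_and_weight_eq_one_of_abs_le p hp w g v hmono hw0 hpos H
  rcases le_total |g a| |g b| with h1 | h1 <;> rcases le_total |g b| |g c| with h2 | h2 <;>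
    rcases le_total |g a| |g c| with h3 | h3
  · exact main hbc.symm hac.symm hab.symm hc hb ha h1 h2 (by tauto)
  · exact main hbc.symm hac.symm hab.symm hc hb ha h1 h2 (by tauto)
  · exact main hbc hab.symm hac.symm hb hc ha h3 h2 (by tauto)
  · exact main hab.symm hbc hac hb ha hc h3 h1 (by tauto)
  · exact main hac.symm hbc.symm hab hc ha hb h1 h3 (by tauto)
  · exact main hac hab hbc.symm ha hc hb h2 h3 (by tauto)
  · exact main hab hac hbc ha hb hc h2 h1 (by tauto)
  · exact main hab hac hbc ha hb hc h2 h1 (by tauto)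

/-- If a strictly monotone Lorentz space `ℓ_{w,p}` (`1 < p < ∞`, all `wᵢ > 0`)
admits a functional `f` with `card (supp f) > 2` whose kernel is the range of a
norm-one projection, then `ℓ_{w,p} = ℓ₂`: `p = 2` and `wᵢ = 1` for all `i`. -/
theorem stmt12 (p : ℝ) (hp : 1 < p)
    (w : ℕ → ℝ) (hmono : Antitone w) (hw0 : w 0 = 1) (hpos : ∀ n, 0 < w n)
    (g : ℕ → ℝ)
    (hsupp : ∃ i j k : ℕ, i ≠ j ∧ j ≠ k ∧ i ≠ k ∧ g i ≠ 0 ∧ g j ≠ 0 ∧ g k ≠ 0)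
    (P : (ℕ → ℝ) →ₗ[ℝ] (ℕ → ℝ))
    (hinto : ∀ x : ℕ → ℝ, lorentzSum w p x ≠ ⊤ →
      Summable (fun n => g n * P x n) ∧ ∑' n, g n * P x n = 0)
    (hfix : ∀ x : ℕ → ℝ, lorentzSum w p x ≠ ⊤ →
      Summable (fun n => g n * x n) → ∑' n, g n * x n = 0 → P x = x)
    (hcontr : ∀ x, lorentzSum w p (P x) ≤ lorentzSum w p x) :
    p = 2 ∧ ∀ n, w n = 1 := by
  obtain ⟨i, j, k, hij, hjk, hik, hi, hj, hk⟩ := hsupp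
  have he := lorentzSum_single_ne_top hp hmono hpos i
  set e : ℕ → ℝ := Pi.single i 1 with hedef
  have hPe : lorentzSum w p (P e) ≠ ⊤ := ne_top_of_le_ne_top he (hcontr e)
  obtain ⟨hPsum, hPzero⟩ := hinto e he
  set v : ℕ → ℝ := e - P e with hvdef
  have hPv : P v = 0 := by
    rw [hvdef, map_sub, hfix _ hPe hPsum hPzero, sub_self]
  have hv : lorentzSum w p v ≠ ⊤ := lorentzSum_sub_ne_top hp hpos he hPe
  have horth : ∀ (σ : Equiv.Perm ℕ) (M : ℕ) (z : ℕ → ℝ),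
      (∀ n, n + 1 < M → |z (n + 1)| < |z n|) → (∀ n, M ≤ n → z n = 0) →
      ∑ n ∈ Finset.range M, g (σ n) * z n = 0 →
      ∑ n ∈ Finset.range M, w n * (|z n| ^ (p - 2) * z n * v (σ n)) = 0 := by
    intro σ M z hz hz0 hker
    refine sum_mul_eq_zero_of_lorentzSum_le hp hmono hpos hv σ hz hz0 fun t => ?_
    have hsum : HasSum (fun n => g n * (z ∘ σ.symm) n) 0 := by
      rw [← σ.hasSum_iff, ← hker]
      have hfinite : HasSum (fun n => g (σ n) * z n) (∑ n ∈ Finset.range M, g (σ n) * z n) :=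
        hasSum_sum_of_ne_finset_zero fun n hn => by simp [hz0 n (by simpa using hn)]
      simpa [Function.comp_def] using hfinite
    have hfin : lorentzSum w p (z ∘ σ.symm) ≠ ⊤ := by
      rw [lorentzSum_eq_sum hp hmono hpos σ (fun n hn => (hz n hn).le) hz0]
      exact ENNReal.ofReal_ne_top
    have hfixed : P (z ∘ σ.symm + t • v) = z ∘ σ.symm := by
      rw [map_add, map_smul, hPv, smul_zero, add_zero, hfix _ hfin hsum.summable hsum.tsum_eq]
    simpa only [hfixed] using hcontr (z ∘ σ.symm + t • v)
  obtain ⟨l, hl⟩ : ∃ l, g l * v l ≠ 0 := by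
    by_contra! hzero
    refine hi ?_
    have hPg : ∀ n, g n * P e n = g n * e n := fun n => by
      have := hzero n
      rw [hvdef, Pi.sub_apply, mul_sub] at this
      linarith
    rw [tsum_congr hPg, tsum_eq_single i (fun n hn => by simp [hedef, hn])] at hPzero
    simpa [hedef] using hPzero
  have hgl := left_ne_zero_of_mul hl
  have hvl := right_ne_zero_of_mul hl
  by_cases hli : l = i
  · subst hli
    exact eq_two_and_weight_eq_one_s12 hp hmono hw0 hpos horth hij hik hjk hgl hj hk (Or.inl hvl)
  by_cases hlj : l = j
  · subst hlj
    exact eq_two_and_weight_eq_one_s12 hp hmono hw0 hpos horth hij.symm hjk hik hgl hi hk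
      (Or.inl hvl)
  exact eq_two_and_weight_eq_one_s12 hp hmono hw0 hpos horth hli hlj hij hgl hi hj (Or.inl hvl)
end
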